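/- Let K be an algebraically closed field of characteristic zero and n ≥ 3. Then rk(x_0x_1(x_1^2 + x_2^2 + ⋯ + x_n^2)) = 4(n−1), and this quartic admits infinitely many Waring decompositions of length 4(n−1). -/

import Mathlib

open MvPolynomial

/-- Apply the iterated partial-derivative operator `∏ i, (∂/∂xᵢ)^(d i)` to `F`. -/
noncomputable def diffOp {K : Type*} [CommSemiring K] {m : ℕ} (d : Fin m →₀ ℕ)
    (F : MvPolynomial (Fin m) K) : MvPolynomial (Fin m) K :=
  (List.finRange m).foldr (fun i G => (⇑(MvPolynomial.pderiv i))^[d i] G) F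

/-- Apolarity action: apply the differential polynomial `δ` (in the dual variables)
to the polynomial `F`. -/
noncomputable def applyDiff {K : Type*} [CommSemiring K] {m : ℕ}
    (δ F : MvPolynomial (Fin m) K) : MvPolynomial (Fin m) K :=
  δ.support.sum fun d => δ.coeff d • diffOp d F

/-- `IsWaringDecomp F d r`: the degree-`d` form `F` lies in the linear span of the
`d`-th powers of `r` linear forms. -/
def IsWaringDecomp {K : Type*} [Field K] {m : ℕ} (F : MvPolynomial (Fin m) K)
    (d r : ℕ) : Prop :=
  ∃ ℓ : Fin r → MvPolynomial (Fin m) K,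
    (∀ j, (ℓ j).IsHomogeneous 1) ∧
    F ∈ Submodule.span K (Set.range fun j => ℓ j ^ d)

/-- The symmetric (Waring) rank of a degree-`d` form. -/
noncomputable def waringRank {K : Type*} [Field K] {m : ℕ}
    (F : MvPolynomial (Fin m) K) (d : ℕ) : ℕ :=
  sInf {r | IsWaringDecomp F d r}

/-- A Waring decomposition of `F` of length `r = L.card`, recorded as a set: a finset
`L` of pairwise non-proportional linear forms whose `d`-th powers span a subspace
containing `F`. -/
def IsSetWaringDecomp {K : Type*} [Field K] {m : ℕ} (F : MvPolynomial (Fin m) K)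
    (d : ℕ) (L : Finset (MvPolynomial (Fin m) K)) : Prop :=
  (∀ ℓ ∈ L, MvPolynomial.IsHomogeneous ℓ 1) ∧
  (∀ ℓ ∈ L, ∀ ℓ' ∈ L, ℓ ≠ ℓ' → ∀ c : K, ℓ ≠ c • ℓ') ∧
  F ∈ Submodule.span K ((fun ℓ => ℓ ^ d) '' ↑L)

/-- `F` has infinitely many essentially different Waring decompositions of length `r`:
the collection of length-`r` decompositions, where two decompositions are identified
when their sets of forms agree up to nonzero scalars (i.e. recorded as sets of lines
in the space of linear forms), is infinite. -/
def InfinitelyManyDecomps {K : Type*} [Field K] {m : ℕ} (F : MvPolynomial (Fin m) K)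
    (d r : ℕ) : Prop :=
  {T : Set (Submodule K (MvPolynomial (Fin m) K)) |
    ∃ L : Finset (MvPolynomial (Fin m) K), L.card = r ∧ IsSetWaringDecomp F d L ∧
      T = (fun ℓ => Submodule.span K {ℓ}) '' ↑L}.Infinite

/-- `∑_{i ≥ t} x_i²`. -/
noncomputable def sumSqFrom (K : Type*) [CommSemiring K] (m t : ℕ) :
    MvPolynomial (Fin m) K :=
  ∑ i ∈ Finset.univ.filter (fun i : Fin m => t ≤ (i : ℕ)), X i ^ 2

theorem Fin.zero_ne_succ_succ {m : ℕ} (i : Fin (m + 2)) : (0 : Fin (m + 4)) ≠ i.succ.succ :=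
  (Fin.succ_ne_zero _).symm

theorem Fin.one_ne_succ_succ {m : ℕ} (i : Fin (m + 2)) : (1 : Fin (m + 4)) ≠ i.succ.succ :=
  (Fin.succ_injective _).ne (Fin.succ_ne_zero i).symm

section LowerBound

variable {K : Type*} [Field K]

/-- If the linear functionals `g ↦ ∑ j, w k j * g j` vanish on all monomials of degree at most `3`
that can occur in the products below, except for `α * β * η k`, then the products
`1, α, β, αβ, η k, α η k, β η k, αβ η k` are linearly independent functions, which bounds
the number of points from below. -/
theorem four_mul_card_succ_le_of_dual_functionals {ι P : Type*} [Fintype ι] [DecidableEq ι]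
    [Nonempty ι] [Fintype P] (E : ι → (P → K) →ₗ[K] K) (α β : P → K) (η : ι → P → K)
    (h1 : ∀ k, E k 1 = 0) (hα : ∀ k, E k α = 0) (hβ : ∀ k, E k β = 0)
    (hη : ∀ k l, E k (η l) = 0)
    (hαα : ∀ k, E k (α * α) = 0) (hββ : ∀ k, E k (β * β) = 0) (hαβ : ∀ k, E k (α * β) = 0)
    (hαη : ∀ k l, E k (α * η l) = 0) (hβη : ∀ k l, E k (β * η l) = 0)
    (hηη : ∀ k l l', E k (η l * η l') = 0)
    (hααβ : ∀ k, E k (α * α * β) = 0) (hαββ : ∀ k, E k (α * β * β) = 0)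
    (hααη : ∀ k l, E k (α * α * η l) = 0)
    (hαβη : ∀ k l, E k (α * β * η l) = if l = k then 1 else 0) :
    4 * (Fintype.card ι + 1) ≤ Fintype.card P := by
  classical
  let μ : Fin 4 → P → K := ![1, α, β, α * β]
  let θ : Option ι → P → K := fun o => o.elim 1 η
  have hli : LinearIndependent K (fun q : Fin 4 × Option ι => μ q.1 * θ q.2) := by
    rw [Fintype.linearIndependent_iff]
    intro c hc
    have hexp : c (0, none) • (1 : P → K) + c (1, none) • α + c (2, none) • β
        + c (3, none) • (α * β)
        + ∑ l, c (0, some l) • η l + ∑ l, c (1, some l) • (α * η l)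
        + ∑ l, c (2, some l) • (β * η l) + ∑ l, c (3, some l) • (α * β * η l) = 0 := by
      rw [← hc, Fintype.sum_prod_type, Fin.sum_univ_four]
      simp only [Fintype.sum_option, μ, θ]
      simp
      abel
    have key : ∀ (k : ι) (g : P → K),
        c (0, none) * E k g + c (1, none) * E k (α * g) + c (2, none) * E k (β * g)
        + c (3, none) * E k (α * β * g)
        + ∑ l, c (0, some l) * E k (η l * g) + ∑ l, c (1, some l) * E k (α * η l * g)
        + ∑ l, c (2, some l) * E k (β * η l * g)
        + ∑ l, c (3, some l) * E k (α * β * η l * g) = 0 := by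
      intro k g
      have := congrArg (fun f => E k (f * g)) hexp
      simpa [add_mul, Finset.sum_mul, map_add, map_sum] using this
    have c3 : ∀ k, c (3, some k) = 0 := by
      intro k
      have := key k 1
      simpa [h1, hα, hβ, hη, hαβ, hαη, hβη, hαβη] using this
    have c2 : ∀ k, c (2, some k) = 0 := by
      intro k
      have := key k α
      have e1 : ∀ l, β * η l * α = α * β * η l := fun l => by ring
      have e2 : ∀ l, α * η l * α = α * α * η l := fun l => by ring
      have e3 : α * β * α = α * α * β := by ring
      simpa [c3, e1, e2, e3, mul_comm β α, mul_comm (η _) α,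
        hα, hαα, hαβ, hααβ, hαη, hααη, hαβη] using this
    have c1 : ∀ k, c (1, some k) = 0 := by
      intro k
      have := key k β
      have e1 : ∀ l, α * η l * β = α * β * η l := fun l => by ring
      simpa [c3, c2, e1, mul_comm (η _) β,
        hβ, hββ, hαβ, hαββ, hβη, hαβη] using this
    have d3 : c (3, none) = 0 := by
      obtain ⟨k⟩ := ‹Nonempty ι›
      have := key k (η k)
      simpa [c3, c2, c1, hη, hηη, hαη, hβη, hαβη] using this
    have c0 : ∀ k, c (0, some k) = 0 := by
      intro k
      have := key k (α * β)
      have e1 : ∀ l, η l * (α * β) = α * β * η l := fun l => by ring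
      have e2 : α * (α * β) = α * α * β := by ring
      have e3 : β * (α * β) = α * β * β := by ring
      simpa [c3, c2, c1, d3, e1, e2, e3, hαβ, hααβ, hαββ, hαβη] using this
    have d2 : c (2, none) = 0 := by
      obtain ⟨k⟩ := ‹Nonempty ι›
      have := key k (α * η k)
      have e1 : β * (α * η k) = α * β * η k := by ring
      have e2 : α * (α * η k) = α * α * η k := by ring
      simpa [c3, c2, c1, c0, d3, e1, e2, hαη, hααη, hαβη] using this
    have d1 : c (1, none) = 0 := by
      obtain ⟨k⟩ := ‹Nonempty ι›
      have := key k (β * η k)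
      have e1 : α * (β * η k) = α * β * η k := by ring
      simpa [c3, c2, c1, c0, d3, d2, e1, hβη, hαβη] using this
    have d0 : c (0, none) = 0 := by
      obtain ⟨k⟩ := ‹Nonempty ι›
      have := key k (α * β * η k)
      simpa [c3, c2, c1, c0, d3, d2, d1, hαβη] using this
    rintro ⟨a, _ | l⟩
    · fin_cases a <;> assumption
    · fin_cases a
      exacts [c0 l, c1 l, c2 l, c3 l]
  have := hli.fintype_card_le_finrank
  simpa using this

/-- A common parameter at which none of finitely many nonzero polynomials vanishes. -/
theorem exists_forall_eval_eq_zero_imp [Infinite K] {P : Type*} [Fintype P]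
    (q : P → Polynomial K) : ∃ τ : K, ∀ j, (q j).eval τ = 0 → q j = 0 := by
  classical
  have hQ : (∏ j, if q j = 0 then 1 else q j) ≠ 0 := by
    rw [Finset.prod_ne_zero_iff]
    intro j _
    split_ifs with h
    exacts [one_ne_zero, h]
  obtain ⟨τ, hτ⟩ : ∃ τ : K, (∏ j, if q j = 0 then 1 else q j).eval τ ≠ 0 := by
    by_contra! h
    exact hQ (Polynomial.funext fun x => by simpa using h x)
  refine ⟨τ, fun j hj => ?_⟩
  by_contra h
  rw [Polynomial.eval_prod, Finset.prod_ne_zero_iff] at hτ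
  exact hτ j (Finset.mem_univ j) (by simp [h, hj])

/-- The derivative in the direction `u`. -/
noncomputable def dirDeriv {m : ℕ} (u : Fin m → K) :
    Derivation K (MvPolynomial (Fin m) K) (MvPolynomial (Fin m) K) :=
  mkDerivation K fun i => C (u i)

theorem dirDeriv_X {m : ℕ} (u : Fin m → K) (i : Fin m) : dirDeriv u (X i) = C (u i) :=
  mkDerivation_X _ _ _

theorem dirDeriv_C {m : ℕ} (u : Fin m → K) (a : K) : dirDeriv u (C a) = 0 :=
  derivation_C _ _

theorem exists_eq_sum_of_isHomogeneous_one {m : ℕ} {l : MvPolynomial (Fin m) K}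
    (hl : l.IsHomogeneous 1) : ∃ p : Fin m → K, l = ∑ i, C (p i) * X i := by
  have h : l ∈ homogeneousSubmodule (Fin m) K 1 := hl
  rw [homogeneousSubmodule_one_eq_span_X, Submodule.mem_span_range_iff_exists_fun] at h
  obtain ⟨p, hp⟩ := h
  exact ⟨p, by simp [← hp, smul_eq_C_mul]⟩

theorem dirDeriv_linear {m : ℕ} (u p : Fin m → K) :
    dirDeriv u (∑ i, C (p i) * X i) = C (p ⬝ᵥ u) := by
  simp [dirDeriv_X, dotProduct, map_sum, Derivation.leibniz]

theorem dirDeriv_four_pow {m : ℕ} (u v w s p : Fin m → K) :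
    dirDeriv u (dirDeriv v (dirDeriv w (dirDeriv s ((∑ i, C (p i) * X i) ^ 4)))) =
      C (24 * ((p ⬝ᵥ u) * (p ⬝ᵥ v) * (p ⬝ᵥ w) * (p ⬝ᵥ s))) := by
  simp only [Derivation.leibniz_pow, Derivation.leibniz, dirDeriv_linear, dirDeriv_C,
    smul_eq_mul, nsmul_eq_mul, map_mul, mul_zero, add_zero, zero_add, Derivation.map_natCast]
  rw [show (C 24 : MvPolynomial (Fin m) K) = 24 from map_ofNat C 24]
  simp
  ring

theorem sumSqFrom_one_eq (m : ℕ) :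
    sumSqFrom K (m + 4) 1 = X 1 ^ 2 + ∑ i : Fin (m + 2), X i.succ.succ ^ 2 := by
  unfold sumSqFrom
  rw [Finset.sum_filter, Fin.sum_univ_succ, Fin.sum_univ_succ]
  simp

theorem dirDeriv_quartic {m : ℕ} (u v w s : Fin (m + 4) → K) (h0 : s 0 = 0) (h1 : s 1 = 0) :
    dirDeriv u (dirDeriv v (dirDeriv w (dirDeriv s (X 0 * X 1 * sumSqFrom K (m + 4) 1)))) =
      C (2 * ((u 0 * v 1 + u 1 * v 0) * (s ⬝ᵥ w) + (u 0 * w 1 + u 1 * w 0) * (s ⬝ᵥ v)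
        + (v 0 * w 1 + v 1 * w 0) * (s ⬝ᵥ u))) := by
  have hs : dirDeriv s (X 0 * X 1 * sumSqFrom K (m + 4) 1) =
      C 2 * (X 0 * X 1 * ∑ i, C (s i) * X i) := by
    rw [sumSqFrom_one_eq, Fin.sum_univ_succ (n := m + 3), Fin.sum_univ_succ (n := m + 2)]
    simp [Derivation.leibniz, Derivation.leibniz_pow, dirDeriv_X, h0, h1, map_sum,
      Finset.mul_sum]
    refine Finset.sum_congr rfl fun i _ => ?_
    rw [show (C 2 : MvPolynomial (Fin (m + 4)) K) = 2 from map_ofNat C 2]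
    ring
  rw [hs]
  simp only [Derivation.leibniz, dirDeriv_linear, dirDeriv_C, dirDeriv_X, map_add,
    smul_eq_mul, map_mul, mul_zero, add_zero, zero_add]
  ring

theorem four_mul_le_of_isWaringDecomp [CharZero K] {m r : ℕ}
    (h : IsWaringDecomp (X 0 * X 1 * sumSqFrom K (m + 4) 1) 4 r) : 4 * (m + 2) ≤ r := by
  obtain ⟨l, hl, hF⟩ := h
  choose p hp using fun j => exists_eq_sum_of_isHomogeneous_one (hl j)
  obtain ⟨c, hc⟩ := (Submodule.mem_span_range_iff_exists_fun K).1 hF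
  have key : ∀ u v w s : Fin (m + 4) → K, s 0 = 0 → s 1 = 0 →
      ∑ j, c j * (24 * ((p j ⬝ᵥ u) * (p j ⬝ᵥ v) * (p j ⬝ᵥ w) * (p j ⬝ᵥ s))) =
      2 * ((u 0 * v 1 + u 1 * v 0) * (s ⬝ᵥ w) + (u 0 * w 1 + u 1 * w 0) * (s ⬝ᵥ v)
        + (v 0 * w 1 + v 1 * w 0) * (s ⬝ᵥ u)) := by
    intro u v w s h0 h1
    apply C_injective (Fin (m + 4)) K
    rw [← dirDeriv_quartic u v w s h0 h1, ← hc]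
    simp only [map_sum, Derivation.map_smul, hp, dirDeriv_four_pow]
    simp only [smul_eq_C_mul, map_mul]
  obtain ⟨τ, hτ⟩ := exists_forall_eval_eq_zero_imp
    fun j => ∑ i : Fin (m + 2), Polynomial.monomial (i : ℕ) (p j i.succ.succ)
  let t : Fin (m + 4) → K := Fin.cons 0 (Fin.cons 0 fun i : Fin (m + 2) => τ ^ (i : ℕ))
  let e : Fin (m + 4) → Fin (m + 4) → K := fun i => Pi.single i 1
  obtain ⟨z, hz0⟩ : ∃ z : Fin (m + 2), z = 0 := ⟨0, rfl⟩
  have hz1 : ∀ l : Fin (m + 1), l.succ ≠ z := fun l => hz0 ▸ Fin.succ_ne_zero l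
  let s : Fin (m + 1) → Fin (m + 4) → K :=
    fun k => e k.succ.succ.succ - τ ^ ((k : ℕ) + 1) • e z.succ.succ
  have ht : ∀ k j, p j ⬝ᵥ t = 0 → p j ⬝ᵥ s k = 0 := by
    intro k j hj
    have h0 := hτ j (by
      rw [← hj]
      simp [t, dotProduct, Fin.sum_univ_succ, Polynomial.eval_finsetSum])
    have hz : ∀ i : Fin (m + 2), p j i.succ.succ = 0 := by
      intro i
      have := congrArg (fun q => Polynomial.coeff q (i : ℕ)) h0
      simpa [Polynomial.finsetSum_coeff, Polynomial.coeff_monomial, Fin.val_inj] using this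
    simp [s, e, dotProduct_sub, hz]
  let E : Fin (m + 1) → (Fin r → K) →ₗ[K] K := fun k =>
    Fintype.linearCombination K fun j => 12 * c j * (p j ⬝ᵥ t) ^ 3 * (p j ⬝ᵥ s k)
  let f : (Fin (m + 4) → K) → Fin r → K := fun u j => (p j ⬝ᵥ u) / (p j ⬝ᵥ t)
  have hs0 : ∀ k, s k 0 = 0 := fun k => by simp [s, e, Fin.zero_ne_succ_succ]
  have hs1 : ∀ k, s k 1 = 0 := fun k => by simp [s, e, Fin.one_ne_succ_succ]
  have hE : ∀ k u v w, E k (f u * f v * f w) =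
      (u 0 * v 1 + u 1 * v 0) * (s k ⬝ᵥ w) + (u 0 * w 1 + u 1 * w 0) * (s k ⬝ᵥ v)
        + (v 0 * w 1 + v 1 * w 0) * (s k ⬝ᵥ u) := by
    intro k u v w
    have h2 : (2 : K) ≠ 0 := two_ne_zero
    apply mul_left_cancel₀ h2
    rw [← key u v w (s k) (hs0 k) (hs1 k), Fintype.linearCombination_apply, Finset.mul_sum]
    refine Finset.sum_congr rfl fun j _ => ?_
    by_cases hj : p j ⬝ᵥ t = 0
    · simp [ht k j hj]
    · simp only [f, Pi.mul_apply, smul_eq_mul]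
      field_simp
      ring
  have hE1 : ∀ k (g : Fin r → K), E k (g * f t) = E k g := by
    intro k g
    simp only [E, Fintype.linearCombination_apply]
    refine Finset.sum_congr rfl fun j _ => ?_
    by_cases hj : p j ⬝ᵥ t = 0
    · simp [ht k j hj]
    · simp [f, hj]
  have hE2 : ∀ k u v, E k (f u * f v) = (u 0 * v 1 + u 1 * v 0) * (s k ⬝ᵥ t)
      + (u 0 * t 1 + u 1 * t 0) * (s k ⬝ᵥ v) + (v 0 * t 1 + v 1 * t 0) * (s k ⬝ᵥ u) :=
    fun k u v => by rw [← hE, hE1]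
  have hE3 : ∀ k u, E k (f u) = (u 0 * t 1 + u 1 * t 0) * (s k ⬝ᵥ t)
      + (u 0 * t 1 + u 1 * t 0) * (s k ⬝ᵥ t) + (t 0 * t 1 + t 1 * t 0) * (s k ⬝ᵥ u) :=
    fun k u => by rw [← hE2, hE1]
  have t0 : t 0 = 0 := rfl
  have t1 : t 1 = 0 := rfl
  have hE4 : ∀ k, E k 1 = 0 := fun k => by
    rw [← hE1, one_mul, hE3]
    simp [t0, t1]
  have t2 : ∀ i : Fin (m + 2), t i.succ.succ = τ ^ (i : ℕ) := fun i => rfl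
  have st : ∀ k, s k ⬝ᵥ t = 0 := fun k => by
    have hz : (z : ℕ) = 0 := congrArg Fin.val hz0
    simp [s, e, sub_dotProduct, t2, hz]
  have e00 : e 0 0 = 1 := by simp [e]
  have e01 : e 0 1 = 0 := by simp [e]
  have e10 : e 1 0 = 0 := by simp [e]
  have e11 : e 1 1 = 1 := by simp [e]
  have el0 : ∀ l : Fin (m + 1), e l.succ.succ.succ 0 = 0 := fun l => by simp [e]
  have el1 : ∀ l : Fin (m + 1), e l.succ.succ.succ 1 = 0 :=
    fun l => by simp [e, Fin.one_ne_succ_succ]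
  have se0 : ∀ k, s k ⬝ᵥ e 0 = 0 := fun k => by simp [e, hs0]
  have se1 : ∀ k, s k ⬝ᵥ e 1 = 0 := fun k => by simp [e, hs1]
  have sel : ∀ k l : Fin (m + 1), s k ⬝ᵥ e l.succ.succ.succ = if l = k then 1 else 0 :=
    fun k l => by simp [s, e, Pi.single_apply, hz1]
  have := four_mul_card_succ_le_of_dual_functionals E (f (e 0)) (f (e 1))
    (fun l => f (e l.succ.succ.succ)) hE4
    (by simp [hE3, t0, t1]) (by simp [hE3, t0, t1]) (by simp [hE3, t0, t1])
    (by simp [hE2, t0, t1, st]) (by simp [hE2, t0, t1, st]) (by simp [hE2, t0, t1, st])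
    (by simp [hE2, t0, t1, st]) (by simp [hE2, t0, t1, st]) (by simp [hE2, t0, t1, st])
    (by simp [hE, e00, e01, e10, e11, se0, se1]) (by simp [hE, e00, e01, e10, e11, se0, se1])
    (by simp [hE, e00, e01, el0, el1, se0])
    (by simp [hE, e00, e01, e10, e11, el0, el1, sel])
  simpa using this

end LowerBound

section Decompositions

variable {K : Type*} [Field K]

theorem IsSetWaringDecomp.isWaringDecomp {m d : ℕ} {F : MvPolynomial (Fin m) K}
    {L : Finset (MvPolynomial (Fin m) K)} (h : IsSetWaringDecomp F d L) :
    IsWaringDecomp F d L.card := by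
  refine ⟨fun j => L.equivFin.symm j, fun j => h.1 _ (L.equivFin.symm j).2, ?_⟩
  convert h.2.2 using 2
  ext q
  simp only [Set.mem_range, Set.mem_image, SetLike.mem_coe]
  constructor
  · rintro ⟨j, rfl⟩
    exact ⟨_, (L.equivFin.symm j).2, rfl⟩
  · rintro ⟨a, ha, rfl⟩
    exact ⟨L.equivFin ⟨a, ha⟩, by simp⟩

/-- The sign `1` or `-1` attached to a boolean. -/
def boolSign (K : Type*) [Field K] (b : Bool) : K := if b then 1 else -1

theorem boolSign_sq (b : Bool) : boolSign K b ^ 2 = 1 := by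
  cases b <;> simp [boolSign]

theorem boolSign_injective [CharZero K] : Function.Injective (boolSign K) := by
  have h : (-1 : K) ≠ 1 := by norm_num
  rintro (_ | _) (_ | _) hab <;> simp_all [boolSign, eq_comm]

/-- The linear forms `± a τ x₀ + x₁ ± γ xᵢ`, `i ≥ 2`, where `a = b` for `i = 2` and `a = 1`
otherwise. -/
noncomputable def signedForm {m : ℕ} (b γ τ : K) (q : Fin (m + 2) × Bool × Bool) :
    MvPolynomial (Fin (m + 4)) K :=
  C (boolSign K q.2.1 * τ * (if q.1 = 0 then b else 1)) * X 0 + X 1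
    + C (boolSign K q.2.2 * γ) * X q.1.succ.succ

theorem signedForm_isHomogeneous {m : ℕ} (b γ τ : K) (q : Fin (m + 2) × Bool × Bool) :
    (signedForm b γ τ q).IsHomogeneous 1 := by
  have h : ∀ (a : K) (i : Fin (m + 4)), (C a * X i).IsHomogeneous 1 := fun a i => by
    simpa using (isHomogeneous_C (Fin (m + 4)) a).mul (isHomogeneous_X K i)
  exact ((h _ _).add (isHomogeneous_X K 1)).add (h _ _)

theorem eval_signedForm {m : ℕ} (b γ τ : K) (q : Fin (m + 2) × Bool × Bool)
    (x : Fin (m + 4) → K) : eval x (signedForm b γ τ q) =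
      boolSign K q.2.1 * τ * (if q.1 = 0 then b else 1) * x 0 + x 1
        + boolSign K q.2.2 * γ * x q.1.succ.succ := by
  simp [signedForm]

theorem signedForm_eq_smul {m : ℕ} {b γ τ τ' a : K} {q q' : Fin (m + 2) × Bool × Bool}
    (h : signedForm b γ τ q = a • signedForm b γ τ' q') : a = 1 := by
  have := congrArg (eval (Pi.single 1 1)) h
  simpa [eval_signedForm, smul_eval, (Fin.one_ne_succ_succ _).symm, eq_comm] using this

theorem signedForm_eq_imp [CharZero K] {m : ℕ} {b γ τ τ' : K} (hγ : γ ≠ 0)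
    {q q' : Fin (m + 2) × Bool × Bool}
    (h : signedForm b γ τ q = signedForm b γ τ' q') :
    q.1 = q'.1 ∧ q.2.2 = q'.2.2 ∧
      boolSign K q.2.1 * τ * (if q.1 = 0 then b else 1)
        = boolSign K q'.2.1 * τ' * (if q.1 = 0 then b else 1) := by
  have hne : ∀ b, boolSign K b ≠ 0 := fun b h0 => by simpa [h0] using boolSign_sq (K := K) b
  have hi : q.1 = q'.1 := by
    by_contra hne'
    have := congrArg (eval (Pi.single q.1.succ.succ 1)) h
    simp [eval_signedForm, hne, hγ, Fin.zero_ne_succ_succ, Fin.one_ne_succ_succ,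
      Ne.symm hne'] at this
  refine ⟨hi, boolSign_injective (K := K) (mul_right_cancel₀ hγ ?_), ?_⟩
  · have := congrArg (eval (Pi.single q.1.succ.succ 1)) h
    simpa [eval_signedForm, ← hi, Fin.zero_ne_succ_succ, Fin.one_ne_succ_succ] using this
  · have := congrArg (eval (Pi.single 0 1)) h
    simpa [eval_signedForm, ← hi, Fin.zero_ne_succ_succ, Fin.one_ne_succ_succ] using this

theorem signedForm_injective [CharZero K] {m : ℕ} {b γ τ : K} (hb : b ≠ 0) (hγ : γ ≠ 0)
    (hτ : τ ≠ 0) : Function.Injective (signedForm (m := m) b γ τ) := by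
  intro q q' h
  obtain ⟨h1, h2, h3⟩ := signedForm_eq_imp hγ h
  have hne : (if q.1 = 0 then b else 1) ≠ 0 := by split_ifs <;> simp [hb]
  exact Prod.ext h1 (Prod.ext
    (boolSign_injective (K := K) (mul_right_cancel₀ hτ (mul_right_cancel₀ hne h3))) h2)

theorem quartic_eq_sum_signedForm [CharZero K] {m : ℕ} {b γ τ : K} (hb0 : b ≠ 0) (hτ : τ ≠ 0)
    (hb : b ^ 2 = -((m : K) + 1)) (hγ : γ ^ 2 = ((m : K) + 2) / 3) :
    X 0 * X 1 * sumSqFrom K (m + 4) 1 = ∑ q : Fin (m + 2) × Bool × Bool,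
      (boolSign K q.2.1 / (16 * ((m : K) + 2) * τ * (if q.1 = 0 then b else 1))) •
        signedForm b γ τ q ^ 4 := by
  have hm : (m : K) + 2 ≠ 0 := by exact_mod_cast (by omega : m + 2 ≠ 0)
  apply MvPolynomial.funext
  intro x
  have hterm : ∀ i : Fin (m + 2),
      ∑ z : Bool × Bool, eval x ((boolSign K z.1 /
        (16 * ((m : K) + 2) * τ * (if i = 0 then b else 1))) • signedForm b γ τ (i, z) ^ 4) =
      x 0 * x 1 ^ 3 / (m + 2) + τ ^ 2 * x 0 ^ 3 * x 1 / (m + 2) * (if i = 0 then b else 1) ^ 2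
        + x 0 * x 1 * x i.succ.succ ^ 2 := by
    intro i
    have hne : (if i = 0 then b else 1) ≠ 0 := by split_ifs <;> simp [hb0]
    simp only [smul_eval, eval_pow, eval_signedForm, Fintype.sum_prod_type, Fintype.sum_bool]
    generalize (if i = 0 then b else 1) = a at hne ⊢
    have h3 : 3 * γ ^ 2 = (m : K) + 2 := by rw [hγ]; ring
    rw [← h3] at hm ⊢
    have hγ0 : γ ≠ 0 := by rintro rfl; simp at hm
    simp [boolSign]
    field_simp
    ring
  rw [map_sum, Fintype.sum_prod_type, Finset.sum_congr rfl fun i _ => hterm i,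
    Finset.sum_add_distrib, Finset.sum_add_distrib, ← Finset.mul_sum, Fin.sum_univ_succ
      (f := fun i : Fin (m + 2) => (if i = 0 then b else 1) ^ 2), sumSqFrom_one_eq]
  simp [hb, mul_add, Finset.mul_sum]
  field_simp

/-- The set of all the linear forms `signedForm b γ τ q`. -/
noncomputable def signedForms (m : ℕ) (b γ τ : K) : Finset (MvPolynomial (Fin (m + 4)) K) :=
  open Classical in Finset.univ.image (signedForm b γ τ)

theorem mem_signedForms {m : ℕ} {b γ τ : K} {l : MvPolynomial (Fin (m + 4)) K} :
    l ∈ signedForms m b γ τ ↔ ∃ q, signedForm b γ τ q = l := by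
  simp [signedForms]

theorem card_signedForms [CharZero K] {m : ℕ} {b γ τ : K} (hb : b ≠ 0) (hγ : γ ≠ 0)
    (hτ : τ ≠ 0) : (signedForms m b γ τ).card = 4 * (m + 2) := by
  classical
  rw [signedForms, Finset.card_image_of_injective _ (signedForm_injective hb hγ hτ)]
  simp
  ring

theorem isSetWaringDecomp_signedForms [CharZero K] {m : ℕ} {b γ τ : K} (hb0 : b ≠ 0)
    (hτ : τ ≠ 0) (hb : b ^ 2 = -((m : K) + 1)) (hγ : γ ^ 2 = ((m : K) + 2) / 3) :
    IsSetWaringDecomp (X 0 * X 1 * sumSqFrom K (m + 4) 1) 4 (signedForms m b γ τ) := by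
  refine ⟨?_, ?_, ?_⟩
  · intro l hl
    obtain ⟨q, rfl⟩ := mem_signedForms.1 hl
    exact signedForm_isHomogeneous b γ τ q
  · intro l hl l' hl' hne a h
    obtain ⟨q, rfl⟩ := mem_signedForms.1 hl
    obtain ⟨q', rfl⟩ := mem_signedForms.1 hl'
    rw [signedForm_eq_smul h, one_smul] at h
    exact hne h
  · rw [quartic_eq_sum_signedForm hb0 hτ hb hγ]
    exact Submodule.sum_mem _ fun q _ => Submodule.smul_mem _ _
      (Submodule.subset_span ⟨_, mem_signedForms.2 ⟨q, rfl⟩, rfl⟩)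

theorem sq_eq_sq_of_span_image_signedForms_eq [CharZero K] {m : ℕ} {b γ τ τ' : K} (hγ : γ ≠ 0)
    (h : (fun l => Submodule.span K {l}) '' (signedForms m b γ τ : Set (MvPolynomial (Fin (m + 4)) K))
      = (fun l => Submodule.span K {l}) '' (signedForms m b γ τ' : Set (MvPolynomial (Fin (m + 4)) K))) :
    τ ^ 2 = τ' ^ 2 := by
  let q : Fin (m + 2) × Bool × Bool := (1, true, true)
  have hmem : Submodule.span K {signedForm b γ τ q} ∈
      (fun l => Submodule.span K {l}) '' (signedForms m b γ τ' : Set (MvPolynomial (Fin (m + 4)) K)) :=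
    h ▸ ⟨_, mem_signedForms.2 ⟨q, rfl⟩, rfl⟩
  obtain ⟨l, hl, hspan⟩ := hmem
  obtain ⟨q', rfl⟩ := mem_signedForms.1 hl
  have : signedForm b γ τ q ∈ Submodule.span K {signedForm b γ τ' q'} := by
    rw [show Submodule.span K {signedForm b γ τ' q'} = _ from hspan]
    exact Submodule.mem_span_singleton_self _
  obtain ⟨a, ha⟩ := Submodule.mem_span_singleton.1 this
  have ha' := ha.symm
  rw [signedForm_eq_smul ha', one_smul] at ha'
  have h3 := (signedForm_eq_imp hγ ha').2.2
  simp only [q, one_ne_zero, if_false, mul_one] at h3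
  have := congrArg (· ^ 2) h3
  simpa [mul_pow, boolSign_sq] using this

end Decompositions

/-- For `n ≥ 3`, `rk(x₀x₁(x₁² + x₂² + ⋯ + x_n²)) = 4(n−1)`, and this
quartic admits infinitely many Waring decompositions of length `4(n−1)`. -/
theorem stmt17 (K : Type*) [Field K] [IsAlgClosed K] [CharZero K] (n : ℕ) (hn : 3 ≤ n) :
    waringRank (X 0 * X 1 * sumSqFrom K (n + 1) 1) 4 = 4 * (n - 1) ∧
    InfinitelyManyDecomps (X 0 * X 1 * sumSqFrom K (n + 1) 1) 4 (4 * (n - 1)) := by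
  obtain ⟨m, rfl⟩ := Nat.exists_eq_add_of_le' hn
  have hcard : 4 * (m + 3 - 1) = 4 * (m + 2) := rfl
  rw [hcard]
  obtain ⟨b, hb⟩ := IsAlgClosed.exists_pow_nat_eq (-((m : K) + 1)) two_pos
  obtain ⟨γ, hγ⟩ := IsAlgClosed.exists_pow_nat_eq (((m : K) + 2) / 3) two_pos
  have hm1 : (m : K) + 1 ≠ 0 := Nat.cast_add_one_ne_zero m
  have hm2 : (m : K) + 2 ≠ 0 := by exact_mod_cast (by omega : m + 2 ≠ 0)
  have hb0 : b ≠ 0 := by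
    rintro rfl
    exact hm1 (by linear_combination hb)
  have hγ0 : γ ≠ 0 := by
    rintro rfl
    exact hm2 (by linear_combination -3 * hγ)
  refine ⟨IsLeast.csInf_eq ⟨?_, fun r hr => four_mul_le_of_isWaringDecomp hr⟩, ?_⟩
  · have := (isSetWaringDecomp_signedForms hb0 one_ne_zero hb hγ).isWaringDecomp
    rwa [card_signedForms hb0 hγ0 one_ne_zero] at this
  · refine Set.infinite_of_injective_forall_mem
      (f := fun k : ℕ => (fun l => Submodule.span K {l}) ''
        (signedForms m b γ ((k : K) + 1) : Set (MvPolynomial (Fin (m + 4)) K))) ?_ ?_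
    · intro k k' h
      have := sq_eq_sq_of_span_image_signedForms_eq hγ0 h
      have h2 : (k + 1) ^ 2 = (k' + 1) ^ 2 := by exact_mod_cast this
      simpa using h2
    · intro k
      have hk : (k : K) + 1 ≠ 0 := Nat.cast_add_one_ne_zero k
      exact ⟨_, card_signedForms hb0 hγ0 hk, isSetWaringDecomp_signedForms hb0 hk hb hγ, rfl⟩
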